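/- arXiv:1909.06252 — 2 statements merged into one kernel-verified Lean document; each statement's English description precedes it below -/
import Mathlib

section
/- Let Q ⊆ ℝⁿ be an axis-parallel cube, let γ > 0, and let F, G ⊆ Q be measurable subsets with |F| ≥ γ|Q| and |G| ≥ γ|Q| (Lebesgue measure). Let 1 ≤ p < ∞. Then there exists a constant C = C(γ, n, p) > 0, independent of Q, F, G, such that for every affine map P : ℝⁿ → ℝⁿ (each component a polynomial of degree at most 1), one has ‖P‖_{L^p(F)} ≤ C ‖P‖_{L^p(G)}. -/
open MeasureTheory ENNReal Set

noncomputable section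

/-- `Q` is an axis-parallel (closed) cube `x₀ + [0,ℓ]ⁿ` with edgelength `ℓ > 0`. -/
def IsAxisCube {n : ℕ} (Q : Set (EuclideanSpace ℝ (Fin n))) : Prop :=
  ∃ (x₀ : EuclideanSpace ℝ (Fin n)) (ℓ : ℝ), 0 < ℓ ∧
    Q = {x | ∀ i, x i ∈ Icc (x₀ i) (x₀ i + ℓ)}

theorem IsAxisCube.nonempty {n : ℕ} {Q : Set (EuclideanSpace ℝ (Fin n))} (hQ : IsAxisCube Q) :
    Q.Nonempty := by
  obtain ⟨x₀, l, hl, rfl⟩ := hQ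
  exact ⟨x₀, fun i => ⟨le_rfl, by linarith⟩⟩

theorem IsAxisCube.convex {n : ℕ} {Q : Set (EuclideanSpace ℝ (Fin n))} (hQ : IsAxisCube Q) :
    Convex ℝ Q := by
  obtain ⟨x₀, l, hl, rfl⟩ := hQ
  intro x hx y hy a b ha hb hab i
  simpa using convex_Icc (x₀ i) (x₀ i + l) (hx i) (hy i) ha hb hab

theorem IsAxisCube.isCompact {n : ℕ} {Q : Set (EuclideanSpace ℝ (Fin n))} (hQ : IsAxisCube Q) :
    IsCompact Q := by
  obtain ⟨x₀, l, hl, rfl⟩ := hQ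
  have h : IsCompact (univ.pi fun i => Icc (x₀ i) (x₀ i + l)) :=
    isCompact_univ_pi fun i => isCompact_Icc
  have h' := h.image (EuclideanSpace.equiv (Fin n) ℝ).symm.continuous
  convert h' using 1
  rw [ContinuousLinearEquiv.image_symm_eq_preimage]
  ext x
  simp only [mem_ofPred_eq, mem_preimage, mem_univ_pi]
  rfl

/-- The part of a compact convex set on which an affine map is small compared with its value at a
given point of the set occupies a small proportion of the set: its homothetic copies centred at
that point are pairwise disjoint. -/
theorem mul_volume_affine_sublevel_le {n : ℕ} {F : Type*} [NormedAddCommGroup F] [NormedSpace ℝ F]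
    {Q : Set (EuclideanSpace ℝ (Fin n))} (hQ : Convex ℝ Q) (hQc : IsCompact Q)
    (P : EuclideanSpace ℝ (Fin n) →ᵃ[ℝ] F) {x₀ : EuclideanSpace ℝ (Fin n)} (hx₀ : x₀ ∈ Q)
    (hP : P x₀ ≠ 0) {N : ℕ} (hN : 0 < N) :
    (N : ℝ≥0∞) * volume {x ∈ Q | ‖P x‖ ≤ ‖P x₀‖ / (8 * N)} ≤ 2 ^ n * volume Q := by
  set S := {x ∈ Q | ‖P x‖ ≤ ‖P x₀‖ / (8 * N)}
  have hNR : (0 : ℝ) < N := by exact_mod_cast hN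
  have hM : 0 < ‖P x₀‖ := norm_pos_iff.2 hP
  have hPc : Continuous P := P.continuous_of_finiteDimensional
  have hSc : IsCompact S := hQc.inter_right (isClosed_le hPc.norm continuous_const)
  let t : ℕ → ℝ := fun k => 1 - k / (2 * N)
  have ht : ∀ k ∈ Finset.range N, 1 / 2 ≤ t k ∧ t k ≤ 1 := by
    intro k hk
    have hk' : (k : ℝ) ≤ N := by exact_mod_cast (Finset.mem_range.1 hk).le
    have h1 : (k : ℝ) / (2 * N) ≤ 1 / 2 := by
      rw [div_le_div_iff₀ (by positivity) (by norm_num)]; linarith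
    have h2 : (0 : ℝ) ≤ k / (2 * N) := by positivity
    constructor <;> simp only [t] <;> linarith
  let A : ℕ → Set (EuclideanSpace ℝ (Fin n)) := fun k => AffineMap.homothety x₀ (t k) '' S
  have hA : ∀ k, MeasurableSet (A k) := fun k =>
    (hSc.image (AffineMap.homothety x₀ (t k)).continuous_of_finiteDimensional).measurableSet
  have hclose : ∀ k ∈ Finset.range N, ∀ y ∈ A k,
      ‖P y - (1 - t k) • P x₀‖ ≤ ‖P x₀‖ / (8 * N) := by
    rintro k hk _ ⟨x, hx, rfl⟩
    obtain ⟨h1, h2⟩ := ht k hk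
    have : P (AffineMap.homothety x₀ (t k) x) - (1 - t k) • P x₀ = t k • P x := by
      rw [AffineMap.homothety_eq_lineMap, AffineMap.apply_lineMap, AffineMap.lineMap_apply_module]
      abel
    rw [this, norm_smul, Real.norm_of_nonneg (by linarith)]
    exact (mul_le_of_le_one_left (norm_nonneg _) h2).trans hx.2
  have hdisj : (↑(Finset.range N) : Set ℕ).PairwiseDisjoint A := by
    intro j hj k hk hjk
    refine Set.disjoint_left.2 fun y hyj hyk => ?_
    have hj' := hclose j hj y hyj
    have hk' := hclose k hk y hyk
    have h3 : ‖(t j - t k) • P x₀‖ ≤ ‖P x₀‖ / (8 * N) + ‖P x₀‖ / (8 * N) := by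
      have : (t j - t k) • P x₀ = (P y - (1 - t j) • P x₀) - (P y - (1 - t k) • P x₀) := by
        module
      rw [this]
      exact (norm_sub_le _ _).trans (add_le_add hj' hk')
    have h4 : 1 / (2 * N) ≤ |t j - t k| := by
      have h5 : t j - t k = ((k : ℤ) - (j : ℤ) : ℤ) / (2 * N) := by
        simp only [t]; push_cast; ring
      have h6 : (1 : ℤ) ≤ |(k : ℤ) - j| := Int.one_le_abs (by omega)
      have h7 : (1 : ℝ) ≤ |(((k : ℤ) - j : ℤ) : ℝ)| := by exact_mod_cast h6
      rw [h5, abs_div, abs_of_pos (by positivity : (0 : ℝ) < 2 * N)]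
      gcongr
    rw [norm_smul, Real.norm_eq_abs] at h3
    have h8 := (mul_le_mul_of_nonneg_right h4 hM.le).trans h3
    have h9 : 1 / (2 * (N : ℝ)) * ‖P x₀‖ = 2 * (‖P x₀‖ / (8 * N) + ‖P x₀‖ / (8 * N)) := by
      field_simp; norm_num
    have h10 : 0 < ‖P x₀‖ / (8 * N) := by positivity
    linarith
  have hsub : (⋃ k ∈ Finset.range N, A k) ⊆ Q := by
    refine iUnion₂_subset fun k hk => ?_
    rintro _ ⟨x, hx, rfl⟩
    obtain ⟨h1, h2⟩ := ht k hk
    rw [AffineMap.homothety_eq_lineMap, AffineMap.lineMap_apply_module]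
    exact hQ hx₀ hx.1 (by linarith) (by linarith) (by ring)
  have hvol : ∀ k ∈ Finset.range N, volume S ≤ 2 ^ n * volume (A k) := by
    intro k hk
    obtain ⟨h1, -⟩ := ht k hk
    simp only [A]
    rw [Measure.addHaar_image_homothety, finrank_euclideanSpace_fin, ← mul_assoc]
    refine le_mul_of_one_le_left' ?_
    have h2 : (2 : ℝ≥0∞) = ENNReal.ofReal 2 := by simp
    rw [h2, ← ENNReal.ofReal_pow (by norm_num), ← ENNReal.ofReal_mul (by positivity),
      ENNReal.one_le_ofReal, abs_of_nonneg (pow_nonneg (by linarith) _), ← mul_pow]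
    exact one_le_pow₀ (by linarith)
  calc (N : ℝ≥0∞) * volume S = ∑ k ∈ Finset.range N, volume S := by simp
    _ ≤ ∑ k ∈ Finset.range N, 2 ^ n * volume (A k) := Finset.sum_le_sum hvol
    _ = 2 ^ n * volume (⋃ k ∈ Finset.range N, A k) := by
      rw [measure_biUnion_finset hdisj fun k _ => hA k, Finset.mul_sum]
    _ ≤ 2 ^ n * volume Q := by gcongr

/-- **Jones' polynomial comparison lemma**: if `F, G` are measurable subsets of a cube `Q`
with `|F|, |G| ≥ γ |Q|`, then for any affine map `P` (degree-one polynomial in each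
component), `‖P‖_{L^p(F)} ≤ C(γ,n,p) ‖P‖_{L^p(G)}`, with `C` independent of `Q, F, G, P`. -/
theorem polynomial_comparison_on_cube
    (n : ℕ) (γ : ℝ) (hγ : 0 < γ) (p : ℝ) (hp : 1 ≤ p) :
    ∃ C : ℝ, 0 < C ∧
      ∀ Q F G : Set (EuclideanSpace ℝ (Fin n)), IsAxisCube Q →
        MeasurableSet F → MeasurableSet G → F ⊆ Q → G ⊆ Q →
        ENNReal.ofReal γ * volume Q ≤ volume F →
        ENNReal.ofReal γ * volume Q ≤ volume G →
        ∀ P : EuclideanSpace ℝ (Fin n) →ᵃ[ℝ] EuclideanSpace ℝ (Fin n),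
          eLpNorm P (ENNReal.ofReal p) (volume.restrict F)
            ≤ ENNReal.ofReal C * eLpNorm P (ENNReal.ofReal p) (volume.restrict G) := by
  have hp0 : 0 < p := by linarith
  obtain ⟨N, hN⟩ := exists_nat_gt (2 ^ n / (γ / 2))
  have hNR : (0 : ℝ) < N := lt_trans (by positivity) hN
  have hN2 : (2 : ℝ) ^ n ≤ γ / 2 * N := by
    rw [div_lt_iff₀ (by positivity)] at hN; linarith
  refine ⟨8 * N * (2 / γ) ^ p⁻¹, by positivity, ?_⟩
  intro Q F G hQ hF hG hFQ hGQ _ hGγ P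
  have hPc : Continuous P := P.continuous_of_finiteDimensional
  obtain ⟨x₀, hx₀, hmax⟩ := hQ.isCompact.exists_isMaxOn hQ.nonempty hPc.norm.continuousOn
  have hQfin : volume Q ≠ ∞ := hQ.isCompact.measure_lt_top.ne
  have hupper : eLpNorm P (ENNReal.ofReal p) (volume.restrict F)
      ≤ volume Q ^ p⁻¹ * ENNReal.ofReal ‖P x₀‖ := by
    have h := eLpNorm_le_of_ae_bound (p := ENNReal.ofReal p) (μ := volume.restrict F) (f := P)
      (C := ‖P x₀‖) ((ae_restrict_iff' hF).2 (ae_of_all _ fun x hx => hmax (hFQ hx)))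
    rw [Measure.restrict_apply_univ, ENNReal.toReal_ofReal hp0.le] at h
    exact h.trans (by gcongr)
  by_cases hP : P x₀ = 0
  · refine hupper.trans ?_
    simp [hP]
  set S := {x ∈ Q | ‖P x‖ ≤ ‖P x₀‖ / (8 * N)}
  have hslab : (N : ℝ≥0∞) * volume S ≤ 2 ^ n * volume Q :=
    mul_volume_affine_sublevel_le hQ.convex hQ.isCompact P hx₀ hP (by exact_mod_cast hNR)
  have hSγ : volume S ≤ ENNReal.ofReal (γ / 2) * volume Q := by
    have h1 : (2 : ℝ≥0∞) ^ n ≤ N * ENNReal.ofReal (γ / 2) := by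
      have := ENNReal.ofReal_le_ofReal hN2
      rwa [ENNReal.ofReal_pow (by norm_num), ENNReal.ofReal_ofNat,
        ENNReal.ofReal_mul (by positivity), ENNReal.ofReal_natCast, mul_comm] at this
    have h2 : (N : ℝ≥0∞) * volume S ≤ N * (ENNReal.ofReal (γ / 2) * volume Q) := by
      rw [← mul_assoc]
      exact hslab.trans (by gcongr)
    exact (ENNReal.mul_le_mul_iff_right (by exact_mod_cast hNR.ne')
      (ENNReal.natCast_ne_top N)).1 h2
  set c := ENNReal.ofReal (‖P x₀‖ / (8 * N)) with hc
  have hGS : ENNReal.ofReal (γ / 2) * volume Q ≤ volume.restrict G {x | c ≤ ‖P x‖ₑ} := by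
    have hcover : G ⊆ ({x | c ≤ ‖P x‖ₑ} ∩ G) ∪ S := by
      intro x hx
      by_cases h : ‖P x‖ ≤ ‖P x₀‖ / (8 * N)
      · exact Or.inr ⟨hGQ hx, h⟩
      · refine Or.inl ⟨?_, hx⟩
        rw [mem_ofPred_eq, ← ofReal_norm]
        exact ENNReal.ofReal_le_ofReal (not_le.1 h).le
    have h1 : ENNReal.ofReal γ * volume Q
        ≤ volume ({x | c ≤ ‖P x‖ₑ} ∩ G) + ENNReal.ofReal (γ / 2) * volume Q :=
      hGγ.trans ((measure_mono hcover).trans ((measure_union_le _ _).trans (by gcongr)))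
    have h2 : ENNReal.ofReal γ = ENNReal.ofReal (γ / 2) + ENNReal.ofReal (γ / 2) := by
      rw [← ENNReal.ofReal_add (by positivity) (by positivity), add_halves]
    rw [h2, add_mul] at h1
    rw [Measure.restrict_apply' hG]
    exact (ENNReal.add_le_add_iff_right (ENNReal.mul_ne_top ENNReal.ofReal_ne_top hQfin)).1 h1
  have hlower : c * (ENNReal.ofReal (γ / 2) * volume Q) ^ p⁻¹
      ≤ eLpNorm P (ENNReal.ofReal p) (volume.restrict G) := by
    have h := mul_meas_ge_le_pow_eLpNorm' (volume.restrict G)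
      (ENNReal.ofReal_pos.2 hp0).ne' ENNReal.ofReal_ne_top
      hPc.aestronglyMeasurable c
    rw [ENNReal.toReal_ofReal hp0.le] at h
    rw [← ENNReal.rpow_le_rpow_iff hp0, ENNReal.mul_rpow_of_nonneg _ _ hp0.le,
      ENNReal.rpow_inv_rpow hp0.ne']
    exact le_trans (by gcongr) h
  refine hupper.trans (le_trans (le_of_eq ?_) (mul_le_mul_right hlower _))
  rw [ENNReal.mul_rpow_of_nonneg _ _ (by positivity), hc,
    ENNReal.ofReal_rpow_of_pos (by positivity)]
  have hconst : ‖P x₀‖ =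
      8 * N * (2 / γ) ^ p⁻¹ * (‖P x₀‖ / (8 * N) * (γ / 2) ^ p⁻¹) := by
    have h1 : (2 / γ) ^ p⁻¹ * (γ / 2) ^ p⁻¹ = 1 := by
      rw [← Real.mul_rpow (by positivity) (by positivity)]
      have : 2 / γ * (γ / 2) = 1 := by field_simp
      rw [this, Real.one_rpow]
    calc ‖P x₀‖ = ‖P x₀‖ * ((2 / γ) ^ p⁻¹ * (γ / 2) ^ p⁻¹) := by rw [h1, mul_one]
      _ = _ := by field_simp
  conv_lhs => rw [hconst]
  rw [ENNReal.ofReal_mul (by positivity),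
    ENNReal.ofReal_mul (p := ‖P x₀‖ / (8 * N)) (by positivity)]
  ring

end
end

section
/- Let m ∈ ℕ. There exists a constant C = C(m) > 0 with the following property. Let S₁, …, S_m be axis-parallel open cubes in ℝ³ forming a chain, i.e. S_r ∩ S_{r+1} ≠ ∅ and 1/4 ≤ ℓ(S_r)/ℓ(S_{r+1}) ≤ 4 for r = 1, …, m−1, where ℓ(S) denotes the edgelength of S. Let v : ℝ³ → ℝ³ be a C¹ vector field whose derivative Dv is bounded on ∪_j S_j. Then sup_{x ∈ S₁} |P_{S₁}(v)(x) − P_{S_m}(v)(x)| ≤ C · ℓ(S₁) · sup_{y ∈ ∪_j S_j} ‖Dv(y)‖, where ‖·‖ is the operator norm on linear maps ℝ³ → ℝ³. -/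
open MeasureTheory ENNReal Metric Set

noncomputable section

abbrev E3 := EuclideanSpace ℝ (Fin 3)

/-- `∂_j v_i (x)` : the `i`-th component of the derivative of `v` at `x` in direction `e_j`. -/
def pderiv3 (v : E3 → E3) (x : E3) (j i : Fin 3) : ℝ :=
  fderiv ℝ v x (EuclideanSpace.single j 1) i

/-- The divergence `div v = ∂₁v₁ + ∂₂v₂ + ∂₃v₃`. -/
def vdiv (v : E3 → E3) (x : E3) : ℝ :=
  ∑ i : Fin 3, pderiv3 v x i i

/-- The curl `curl v = (∂₂v₃ − ∂₃v₂, ∂₃v₁ − ∂₁v₃, ∂₁v₂ − ∂₂v₁)`. -/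
def vcurl (v : E3 → E3) (x : E3) : E3 :=
  (WithLp.equiv 2 (Fin 3 → ℝ)).symm
    ![pderiv3 v x 1 2 - pderiv3 v x 2 1,
      pderiv3 v x 2 0 - pderiv3 v x 0 2,
      pderiv3 v x 0 1 - pderiv3 v x 1 0]

/-- The barycenter `x̄ = (1/|S|) ∫_S x dx` of `S`. -/
def bary (S : Set E3) : E3 := ((volume S).toReal)⁻¹ • ∫ x in S, x

/-- The mean value `a = (1/|S|) ∫_S u dx` of `u` over `S`. -/
def avgVF (S : Set E3) (u : E3 → E3) : E3 := ((volume S).toReal)⁻¹ • ∫ x in S, u x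

/-- The symmetrized mean gradient matrix `b_ij = (1/(2|S|)) ∫_S (∂u_i/∂x_j + ∂u_j/∂x_i) dx`. -/
def bmat (S : Set E3) (u : E3 → E3) (i j : Fin 3) : ℝ :=
  (2 * (volume S).toReal)⁻¹ * ∫ x in S, (pderiv3 u x j i + pderiv3 u x i j)

/-- The affine vector field `P_S(u)(x) = a + B(x − x̄)`. -/
def PS (S : Set E3) (u : E3 → E3) (x : E3) : E3 :=
  (WithLp.equiv 2 (Fin 3 → ℝ)).symm
    (fun i => avgVF S u i + ∑ j, bmat S u i j * (x j - bary S j))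

/-- The open axis-parallel cube with corner `x₀` and edgelength `ℓ`. -/
def openAxisCube (x₀ : E3) (ℓ : ℝ) : Set E3 :=
  {x | ∀ i, x i ∈ Ioo (x₀ i) (x₀ i + ℓ)}

lemma norm_le_two_mul_of_forall_abs_le {w : E3} {c : ℝ} (hc : 0 ≤ c) (h : ∀ i, |w i| ≤ c) :
    ‖w‖ ≤ 2 * c := by
  have hsq : ∀ i, ‖w i‖ ^ 2 ≤ c ^ 2 := fun i => by
    rw [Real.norm_eq_abs]; exact pow_le_pow_left₀ (abs_nonneg _) (h i) 2
  rw [EuclideanSpace.norm_eq, Fin.sum_univ_three]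
  apply Real.sqrt_le_iff.2 ⟨by positivity, ?_⟩
  nlinarith [hsq 0, hsq 1, hsq 2, sq_nonneg c]

lemma norm_sub_le_of_mem_openAxisCube {x₀ p q : E3} {ℓ : ℝ} (hℓ : 0 ≤ ℓ)
    (hp : p ∈ openAxisCube x₀ ℓ) (hq : q ∈ openAxisCube x₀ ℓ) : ‖p - q‖ ≤ 2 * ℓ := by
  refine norm_le_two_mul_of_forall_abs_le hℓ fun i => ?_
  have h1 := hp i
  have h2 := hq i
  simp only [mem_Ioo] at h1 h2
  rw [PiLp.sub_apply, abs_le]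
  constructor <;> linarith

lemma convex_openAxisCube (x₀ : E3) (ℓ : ℝ) : Convex ℝ (openAxisCube x₀ ℓ) := by
  intro p hp q hq a b ha hb hab i
  have := (convex_Ioo (x₀ i) (x₀ i + ℓ)) (hp i) (hq i) ha hb hab
  simpa using this

lemma isOpen_openAxisCube (x₀ : E3) (ℓ : ℝ) : IsOpen (openAxisCube x₀ ℓ) := by
  have : openAxisCube x₀ ℓ = ⋂ i, (fun x : E3 => x i) ⁻¹' Ioo (x₀ i) (x₀ i + ℓ) := by
    ext; simp [openAxisCube]
  rw [this]
  exact isOpen_iInter_of_finite fun i => isOpen_Ioo.preimage (by fun_prop)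

lemma openAxisCube_subset_closedBall {x₀ p : E3} {ℓ : ℝ} (hℓ : 0 ≤ ℓ)
    (hp : p ∈ openAxisCube x₀ ℓ) : openAxisCube x₀ ℓ ⊆ closedBall p (2 * ℓ) := fun q hq => by
  rw [mem_closedBall, dist_eq_norm]
  exact norm_sub_le_of_mem_openAxisCube hℓ hq hp

lemma volume_openAxisCube_ne_top {x₀ p : E3} {ℓ : ℝ} (hℓ : 0 ≤ ℓ)
    (hp : p ∈ openAxisCube x₀ ℓ) : volume (openAxisCube x₀ ℓ) ≠ ∞ :=
  ((measure_mono (openAxisCube_subset_closedBall hℓ hp)).trans_lt measure_closedBall_lt_top).ne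

lemma volume_openAxisCube_ne_zero {x₀ p : E3} {ℓ : ℝ}
    (hp : p ∈ openAxisCube x₀ ℓ) : volume (openAxisCube x₀ ℓ) ≠ 0 :=
  ((isOpen_openAxisCube x₀ ℓ).measure_pos volume ⟨p, hp⟩).ne'

/-- The mean of a continuous field over a cube stays as close to a given vector as its values. -/
lemma norm_avgVF_sub_le {x₀ p c : E3} {ℓ R : ℝ} (hℓ : 0 ≤ ℓ) (hp : p ∈ openAxisCube x₀ ℓ)
    {u : E3 → E3} (hu : Continuous u) (h : ∀ q ∈ openAxisCube x₀ ℓ, ‖u q - c‖ ≤ R) :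
    ‖avgVF (openAxisCube x₀ ℓ) u - c‖ ≤ R := by
  have hint : IntegrableOn u (openAxisCube x₀ ℓ) :=
    (hu.continuousOn.integrableOn_compact (isCompact_closedBall p (2 * ℓ))).mono_set
      (openAxisCube_subset_closedBall hℓ hp)
  have hmem := (convex_closedBall c R).set_average_mem isClosed_closedBall
    (volume_openAxisCube_ne_zero hp) (volume_openAxisCube_ne_top hℓ hp)
    (ae_restrict_of_forall_mem (isOpen_openAxisCube x₀ ℓ).measurableSet fun q hq => by
      rw [mem_closedBall, dist_eq_norm]; exact h q hq) hint
  rwa [setAverage_eq, mem_closedBall, dist_eq_norm] at hmem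

lemma abs_pderiv3_le (v : E3 → E3) (x : E3) (j i : Fin 3) :
    |pderiv3 v x j i| ≤ ‖fderiv ℝ v x‖ := by
  rw [pderiv3, ← Real.norm_eq_abs]
  refine (PiLp.norm_apply_le _ i).trans ?_
  simpa using (fderiv ℝ v x).le_opNorm (EuclideanSpace.single j 1)

lemma abs_bmat_le {x₀ p : E3} {ℓ M : ℝ} (hℓ : 0 ≤ ℓ) (hp : p ∈ openAxisCube x₀ ℓ)
    {v : E3 → E3} (h : ∀ q ∈ openAxisCube x₀ ℓ, ‖fderiv ℝ v q‖ ≤ M) (i j : Fin 3) :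
    |bmat (openAxisCube x₀ ℓ) v i j| ≤ M := by
  have hfin := volume_openAxisCube_ne_top hℓ hp
  have hpos := ENNReal.toReal_pos (volume_openAxisCube_ne_zero hp) hfin
  have hI := norm_setIntegral_le_of_norm_le_const hfin.lt_top
    (f := fun x => pderiv3 v x j i + pderiv3 v x i j) (C := 2 * M) fun q hq => by
      refine (norm_add_le _ _).trans ?_
      have h1 := (abs_pderiv3_le v q j i).trans (h q hq)
      have h2 := (abs_pderiv3_le v q i j).trans (h q hq)
      rw [Real.norm_eq_abs, Real.norm_eq_abs]
      linarith
  rw [bmat, abs_mul, abs_of_pos (by positivity : 0 < (2 * (volume (openAxisCube x₀ ℓ)).toReal)⁻¹),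
    inv_mul_le_iff₀ (by positivity)]
  rw [Real.norm_eq_abs, measureReal_def] at hI
  linarith

/-- On a cube with `‖Dv‖ ≤ M`, the field `v` is `M`-Lipschitz. -/
lemma norm_sub_le_of_fderiv_le {x₀ p q : E3} {ℓ M : ℝ} {v : E3 → E3} (hv : ContDiff ℝ 1 v)
    (h : ∀ q ∈ openAxisCube x₀ ℓ, ‖fderiv ℝ v q‖ ≤ M)
    (hp : p ∈ openAxisCube x₀ ℓ) (hq : q ∈ openAxisCube x₀ ℓ) : ‖v p - v q‖ ≤ M * ‖p - q‖ :=
  (convex_openAxisCube x₀ ℓ).norm_image_sub_le_of_norm_fderiv_le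
    (fun _ _ => (hv.differentiable one_ne_zero).differentiableAt) h hq hp

/-- Distance between `P_S(v)` at an arbitrary point and the value of `v` at a point of `S`. -/
lemma norm_PS_sub_le {x₀ p : E3} {ℓ M : ℝ} (hℓ : 0 ≤ ℓ) (hp : p ∈ openAxisCube x₀ ℓ)
    {v : E3 → E3} (hv : ContDiff ℝ 1 v) (h : ∀ q ∈ openAxisCube x₀ ℓ, ‖fderiv ℝ v q‖ ≤ M)
    (x : E3) :
    ‖PS (openAxisCube x₀ ℓ) v x - v p‖ ≤ (14 * ℓ + 6 * ‖p - x‖) * M := by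
  have hM : 0 ≤ M := (norm_nonneg _).trans (h p hp)
  set S := openAxisCube x₀ ℓ with hS
  have havg : ‖avgVF S v - v p‖ ≤ M * (2 * ℓ) :=
    norm_avgVF_sub_le hℓ hp hv.continuous fun q hq =>
      (norm_sub_le_of_fderiv_le hv h hq hp).trans
        (mul_le_mul_of_nonneg_left (norm_sub_le_of_mem_openAxisCube hℓ hq hp) hM)
  have hbary : ‖bary S - p‖ ≤ 2 * ℓ :=
    norm_avgVF_sub_le hℓ hp continuous_id fun q hq => norm_sub_le_of_mem_openAxisCube hℓ hq hp
  have hxb : ‖x - bary S‖ ≤ ‖p - x‖ + 2 * ℓ := by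
    have := norm_sub_le (x - p) (bary S - p)
    rw [sub_sub_sub_cancel_right, norm_sub_rev x p] at this
    linarith
  have hlin : ‖PS S v x - avgVF S v‖ ≤ 2 * (3 * (M * (‖p - x‖ + 2 * ℓ))) := by
    refine norm_le_two_mul_of_forall_abs_le (by positivity) fun i => ?_
    have hterm : ∀ j, |bmat S v i j * (x j - bary S j)| ≤ M * (‖p - x‖ + 2 * ℓ) := fun j => by
      rw [abs_mul]
      refine mul_le_mul (abs_bmat_le hℓ hp h i j) ?_ (abs_nonneg _) hM
      exact (PiLp.norm_apply_le (x - bary S) j).trans hxb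
    have heq : (PS S v x - avgVF S v) i = ∑ j, bmat S v i j * (x j - bary S j) := by
      simp [PS]
    rw [heq]
    refine (Finset.abs_sum_le_sum_abs _ _).trans ((Finset.sum_le_sum fun j _ => hterm j).trans ?_)
    simp
  have := norm_add_le (PS S v x - avgVF S v) (avgVF S v - v p)
  rw [sub_add_sub_cancel] at this
  linarith

lemma chain_edge_le {m : ℕ} (hm : 0 < m) {ℓ : Fin m → ℝ} (hℓ : ∀ r, 0 < ℓ r)
    (hratio : ∀ (r : Fin m) (h : r.1 + 1 < m), 1 / 4 ≤ ℓ r / ℓ ⟨r.1 + 1, h⟩)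
    (n : ℕ) (hn : n < m) : ℓ ⟨n, hn⟩ ≤ 4 ^ n * ℓ ⟨0, hm⟩ := by
  induction n with
  | zero => simp
  | succ k ih =>
    have h1 := ih (Nat.lt_of_succ_lt hn)
    have h2 := hratio ⟨k, Nat.lt_of_succ_lt hn⟩ hn
    rw [le_div_iff₀ (hℓ _)] at h2
    rw [pow_succ]
    linarith

/-- Points of the `n`-th cube of a chain are close to points of the first cube, and so are the
values of a field with bounded derivative. -/
lemma chain_dist_le {m : ℕ} (hm : 0 < m) {x₀ : Fin m → E3} {ℓ : Fin m → ℝ} (hℓ : ∀ r, 0 < ℓ r)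
    (hinter : ∀ (r : Fin m) (h : r.1 + 1 < m),
      (openAxisCube (x₀ r) (ℓ r) ∩
        openAxisCube (x₀ ⟨r.1 + 1, h⟩) (ℓ ⟨r.1 + 1, h⟩)).Nonempty)
    (hratio : ∀ (r : Fin m) (h : r.1 + 1 < m), 1 / 4 ≤ ℓ r / ℓ ⟨r.1 + 1, h⟩)
    {v : E3 → E3} (hv : ContDiff ℝ 1 v) {M : ℝ}
    (hM : ∀ r, ∀ y ∈ openAxisCube (x₀ r) (ℓ r), ‖fderiv ℝ v y‖ ≤ M)
    {x : E3} (hx : x ∈ openAxisCube (x₀ ⟨0, hm⟩) (ℓ ⟨0, hm⟩)) (n : ℕ) (hn : n < m) :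
    ∀ p ∈ openAxisCube (x₀ ⟨n, hn⟩) (ℓ ⟨n, hn⟩),
      ‖p - x‖ ≤ 4 ^ (n + 1) * ℓ ⟨0, hm⟩ ∧ ‖v p - v x‖ ≤ M * (4 ^ (n + 1) * ℓ ⟨0, hm⟩) := by
  have hM0 : 0 ≤ M := (norm_nonneg _).trans (hM _ x hx)
  have hℓ0 := hℓ ⟨0, hm⟩
  induction n with
  | zero =>
    intro p hp
    have h1 := norm_sub_le_of_mem_openAxisCube hℓ0.le hp hx
    have h2 : ‖p - x‖ ≤ 4 ^ (0 + 1) * ℓ ⟨0, hm⟩ := by norm_num; linarith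
    exact ⟨h2, (norm_sub_le_of_fderiv_le hv (hM _) hp hx).trans
      (mul_le_mul_of_nonneg_left h2 hM0)⟩
  | succ k ih =>
    intro p hp
    obtain ⟨q, hq, hq'⟩ := hinter ⟨k, Nat.lt_of_succ_lt hn⟩ hn
    obtain ⟨h1, h2⟩ := ih (Nat.lt_of_succ_lt hn) q hq
    have hedge := chain_edge_le hm hℓ hratio (k + 1) hn
    have hpq := norm_sub_le_of_mem_openAxisCube (hℓ _).le hp hq'
    have hpq' : ‖p - q‖ ≤ 2 * (4 ^ (k + 1) * ℓ ⟨0, hm⟩) := by linarith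
    have hvpq := (norm_sub_le_of_fderiv_le hv (hM _) hp hq').trans
      (mul_le_mul_of_nonneg_left hpq' hM0)
    have t1 := norm_add_le (p - q) (q - x)
    have t2 := norm_add_le (v p - v q) (v q - v x)
    rw [sub_add_sub_cancel] at t1 t2
    have hpos : 0 ≤ 4 ^ (k + 1) * ℓ ⟨0, hm⟩ := by positivity
    have hpos' := mul_nonneg hM0 hpos
    rw [pow_succ 4 (k + 1)]
    constructor <;> linarith

lemma openAxisCube_nonempty (x₀ : E3) {ℓ : ℝ} (hℓ : 0 < ℓ) : (openAxisCube x₀ ℓ).Nonempty :=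
  ⟨WithLp.toLp 2 fun i => x₀ i + ℓ / 2, fun i => by
    simp only [mem_Ioo]; constructor <;> linarith⟩

/-- On the first cube of a chain, the affine field of the `n`-th cube is close to `v`. -/
lemma chain_norm_PS_sub_le {m : ℕ} (hm : 0 < m) {x₀ : Fin m → E3} {ℓ : Fin m → ℝ}
    (hℓ : ∀ r, 0 < ℓ r)
    (hinter : ∀ (r : Fin m) (h : r.1 + 1 < m),
      (openAxisCube (x₀ r) (ℓ r) ∩
        openAxisCube (x₀ ⟨r.1 + 1, h⟩) (ℓ ⟨r.1 + 1, h⟩)).Nonempty)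
    (hratio : ∀ (r : Fin m) (h : r.1 + 1 < m), 1 / 4 ≤ ℓ r / ℓ ⟨r.1 + 1, h⟩)
    {v : E3 → E3} (hv : ContDiff ℝ 1 v) {M : ℝ}
    (hM : ∀ r, ∀ y ∈ openAxisCube (x₀ r) (ℓ r), ‖fderiv ℝ v y‖ ≤ M)
    {x : E3} (hx : x ∈ openAxisCube (x₀ ⟨0, hm⟩) (ℓ ⟨0, hm⟩)) (n : ℕ) (hn : n < m) :
    ‖PS (openAxisCube (x₀ ⟨n, hn⟩) (ℓ ⟨n, hn⟩)) v x - v x‖ ≤ 42 * 4 ^ n * ℓ ⟨0, hm⟩ * M := by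
  have hM0 : 0 ≤ M := (norm_nonneg _).trans (hM _ x hx)
  obtain ⟨p, hp⟩ := openAxisCube_nonempty (x₀ ⟨n, hn⟩) (hℓ ⟨n, hn⟩)
  obtain ⟨h1, h2⟩ := chain_dist_le hm hℓ hinter hratio hv hM hx n hn p hp
  have hedge := chain_edge_le hm hℓ hratio n hn
  have hPS := norm_PS_sub_le (hℓ _).le hp hv (hM _) x
  have hle : (14 * ℓ ⟨n, hn⟩ + 6 * ‖p - x‖) * M ≤
      (14 * (4 ^ n * ℓ ⟨0, hm⟩) + 6 * (4 ^ (n + 1) * ℓ ⟨0, hm⟩)) * M :=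
    mul_le_mul_of_nonneg_right (by linarith) hM0
  calc _ ≤ _ + ‖v p - v x‖ := norm_sub_le_norm_sub_add_norm_sub _ (v p) _
    _ ≤ (14 * (4 ^ n * ℓ ⟨0, hm⟩) + 6 * (4 ^ (n + 1) * ℓ ⟨0, hm⟩)) * M +
        M * (4 ^ (n + 1) * ℓ ⟨0, hm⟩) := add_le_add (hPS.trans hle) h2
    _ = 42 * 4 ^ n * ℓ ⟨0, hm⟩ * M := by ring

/-- Sup-norm comparison of the affine fields along a chain of cubes: for a chain
`S₁, …, S_m` of axis-parallel cubes with comparable edgelengths and a `C¹` vector field `v`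
with `‖Dv‖ ≤ M` on the union,
`sup_{x ∈ S₁} |P_{S₁}(v)(x) − P_{S_m}(v)(x)| ≤ C(m) ℓ(S₁) M`. -/
theorem sup_PS_chain_le
    (m : ℕ) (hm : 0 < m) :
    ∃ C : ℝ, 0 < C ∧
      ∀ (x₀ : Fin m → E3) (ℓ : Fin m → ℝ) (S : Fin m → Set E3),
        (∀ r, 0 < ℓ r) →
        (∀ r, S r = openAxisCube (x₀ r) (ℓ r)) →
        (∀ (r : Fin m) (h : r.1 + 1 < m), (S r ∩ S ⟨r.1 + 1, h⟩).Nonempty) →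
        (∀ (r : Fin m) (h : r.1 + 1 < m),
          1 / 4 ≤ ℓ r / ℓ ⟨r.1 + 1, h⟩ ∧ ℓ r / ℓ ⟨r.1 + 1, h⟩ ≤ 4) →
        ∀ v : E3 → E3, ContDiff ℝ 1 v →
          ∀ M : ℝ, (∀ y ∈ ⋃ j, S j, ‖fderiv ℝ v y‖ ≤ M) →
            ∀ x ∈ S ⟨0, hm⟩,
              ‖PS (S ⟨0, hm⟩) v x - PS (S ⟨m - 1, Nat.sub_lt hm one_pos⟩) v x‖
                ≤ C * ℓ ⟨0, hm⟩ * M := by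
  refine ⟨42 + 42 * 4 ^ (m - 1), by positivity, ?_⟩
  intro x₀ ℓ S hℓ hS hinter hratio v hv M hM x hx
  obtain rfl : S = fun r => openAxisCube (x₀ r) (ℓ r) := funext hS
  have hclose := chain_norm_PS_sub_le hm hℓ hinter (fun r h => (hratio r h).1) hv
    (fun r y hy => hM y (mem_iUnion_of_mem r hy)) hx
  have h0 := hclose 0 hm
  have h1 := hclose (m - 1) (Nat.sub_lt hm one_pos)
  rw [norm_sub_rev] at h1
  refine (norm_sub_le_norm_sub_add_norm_sub _ (v x) _).trans ((add_le_add h0 h1).trans_eq ?_)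
  ring

end
end
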